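/- Let d, κ, L₁, L₂ ∈ (0,∞), c₀ > 1, c₁ > 0, Γ = (L₁𝕋)×(L₂𝕋), Ω = Γ×(−d,0). Let η̄ : Γ×[−d,0] → ℝ be continuously differentiable, set d̃ = 1+x₃/d, A = ∂₁η̄·d̃, B = ∂₂η̄·d̃, J = 1+η̄/d+∂₃η̄·d̃, K = 1/J, and let 𝒜 be the matrix with rows (1,0,−AK), (0,1,−BK), (0,0,K). Assume 1/c₀ ≤ J ≤ c₀ on Ω and that (1/c₁)|v|² ≤ (J𝒜ᵀ𝒜 v)·v ≤ c₁|v|² for all v ∈ ℝ³ at every point of Ω. Then for every continuously differentiable φ : Γ×[−d,0] → ℝ with ∫_Ω J φ dx = 0, (μ̄₀/(c₀c₁)) ∫_Ω |φ|² J dx ≤ κ∫_Ω J|∇_𝒜φ|² dx, where μ̄₀ = κπ² min{1/d², 4/L₁², 4/L₂²} and (∇_𝒜φ)_i = ∑_k 𝒜_{ik}∂_kφ. -/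

import Mathlib

open MeasureTheory Real Set

noncomputable section

/-- Partial derivative of `f : ℝ³ → ℝ` in the `i`-th coordinate direction. -/
def pd (i : Fin 3) (f : (Fin 3 → ℝ) → ℝ) (x : Fin 3 → ℝ) : ℝ :=
  fderiv ℝ f x (Pi.single i 1)

/-- Fundamental domain `(0,L₁)×(0,L₂)×(−d,0)` of the periodic slab `Ω = Γ×(−d,0)`. -/
def slab (L₁ L₂ d : ℝ) : Set (Fin 3 → ℝ) :=
  Set.univ.pi ![Ioo 0 L₁, Ioo 0 L₂, Ioo (-d) 0]

/-- Near a zero `c` of a differentiable `f`, the function `f² cot(k(x - c))` is continuous. -/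
lemma continuousAt_sq_mul_cot_of_zero {f f' : ℝ → ℝ} {k c : ℝ} (hk : k ≠ 0)
    (hf : ∀ x, HasDerivAt f (f' x) x) (hc : f c = 0) :
    ContinuousAt (fun x => f x ^ 2 * (cos (k * (x - c)) / sin (k * (x - c)))) c := by
  set s : ℝ → ℝ := fun x => sin (k * (x - c)) with hs
  have hsd : HasDerivAt s k c := by
    simpa using (((hasDerivAt_id c).sub_const c).const_mul k).sin
  have hs0 : dslope s c c = k := by rw [dslope_same, hsd.deriv]
  have hfs : ContinuousAt (dslope f c) c :=
    continuousAt_dslope_same.2 (hf c).differentiableAt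
  have hss : ContinuousAt (dslope s c) c :=
    continuousAt_dslope_same.2 hsd.differentiableAt
  have heq : (fun x => f x ^ 2 * (cos (k * (x - c)) / sin (k * (x - c)))) =
      fun x => f x * dslope f c x * cos (k * (x - c)) / dslope s c x := by
    funext x
    have h1 := sub_smul_dslope f c x
    have h2 := sub_smul_dslope s c x
    simp only [hc, smul_eq_mul, sub_zero] at h1
    simp only [hs, sub_self, mul_zero, sin_zero, smul_eq_mul, sub_zero] at h2
    by_cases hx : x = c
    · simp [hx, hc]
    · have hx' : x - c ≠ 0 := sub_ne_zero.2 hx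
      rw [← h2, sq]
      nth_rewrite 2 [← h1]
      rw [← hs]
      field_simp
  rw [heq]
  exact (((hf c).continuousAt.mul hfs).mul (by fun_prop)).div hss (by rwa [hs0])

/-- Sharp Poincaré (Friedrichs) inequality on an interval for functions vanishing at both ends. -/
lemma dirichlet_poincare {f f' : ℝ → ℝ} {a b : ℝ} (hab : a < b)
    (hf : ∀ x, HasDerivAt f (f' x) x) (hf' : Continuous f') (ha : f a = 0) (hb : f b = 0) :
    (π / (b - a)) ^ 2 * (∫ x in a..b, f x ^ 2) ≤ ∫ x in a..b, f' x ^ 2 := by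
  have hba : 0 < b - a := sub_pos.2 hab
  set k := π / (b - a) with hk
  have hk0 : 0 < k := div_pos pi_pos hba
  have hkb : k * (b - a) = π := by rw [hk]; field_simp
  have hfc : Continuous f := continuous_iff_continuousAt.2 fun x => (hf x).continuousAt
  have hsin : ∀ x ∈ Ioo a b, sin (k * (x - a)) ≠ 0 := fun x hx =>
    (sin_pos_of_pos_of_lt_pi (mul_pos hk0 (sub_pos.2 hx.1)) (by
      rw [← hkb]; exact mul_lt_mul_of_pos_left (by linarith [hx.2]) hk0)).ne'
  set h : ℝ → ℝ := fun x => f x ^ 2 * (cos (k * (x - a)) / sin (k * (x - a))) with hh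
  have hhb : h = fun x => f x ^ 2 * (cos (k * (x - b)) / sin (k * (x - b))) := by
    funext x
    have : k * (x - a) = k * (x - b) + π := by rw [← hkb]; ring
    simp only [hh, this, cos_add_pi, sin_add_pi, neg_div_neg_eq]
  have hhd : ∀ x ∈ Ioo a b, HasDerivAt h (2 * f x * f' x *
      (cos (k * (x - a)) / sin (k * (x - a))) -
      f x ^ 2 * k * (1 + (cos (k * (x - a)) / sin (k * (x - a))) ^ 2)) x := by
    intro x hx
    have hs := hsin x hx
    have hl : HasDerivAt (fun x => k * (x - a)) k x := by
      simpa using ((hasDerivAt_id x).sub_const a).const_mul k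
    have := ((hf x).pow 2).mul (hl.cos.div hl.sin hs)
    refine this.congr_deriv ?_
    push_cast
    simp only [neg_mul, pow_one, Pi.pow_apply, Pi.div_apply]
    field_simp
    ring
  have hhc : ContinuousOn h (Icc a b) := by
    intro x hx
    apply ContinuousAt.continuousWithinAt
    rcases eq_or_lt_of_le hx.1 with rfl | h1
    · exact continuousAt_sq_mul_cot_of_zero hk0.ne' hf ha
    rcases eq_or_lt_of_le hx.2 with rfl | h2
    · rw [hhb]; exact continuousAt_sq_mul_cot_of_zero hk0.ne' hf hb
    · exact (hhd x ⟨h1, h2⟩).continuousAt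
  have hGc : Continuous fun x => f' x ^ 2 - k ^ 2 * f x ^ 2 := by fun_prop
  have hmono : MonotoneOn
      (fun x => (∫ t in a..x, (f' t ^ 2 - k ^ 2 * f t ^ 2)) - k * h x) (Icc a b) := by
    refine monotoneOn_of_hasDerivWithinAt_nonneg (convex_Icc a b) (f' := fun x =>
      (f' x - k * (cos (k * (x - a)) / sin (k * (x - a))) * f x) ^ 2) ?_ ?_
      fun x _ => sq_nonneg _
    · exact ContinuousOn.sub (by fun_prop) (continuousOn_const.mul hhc)
    · intro x hx
      rw [interior_Icc] at hx
      have h1 := intervalIntegral.integral_hasDerivAt_right (hGc.intervalIntegrable a x)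
        (hGc.stronglyMeasurableAtFilter _ _) hGc.continuousAt
      have h2 := h1.sub ((hhd x hx).const_mul k)
      exact (h2.congr_deriv (by ring)).hasDerivWithinAt
  have hle := hmono (left_mem_Icc.2 hab.le) (right_mem_Icc.2 hab.le) hab.le
  have e1 : h a = 0 := by simp [hh, ha]
  have e2 : h b = 0 := by simp [hh, hb]
  simp only [e1, e2, intervalIntegral.integral_same, mul_zero, sub_zero] at hle
  rw [intervalIntegral.integral_sub
    ((by fun_prop : Continuous fun x => f' x ^ 2).intervalIntegrable _ _)
    ((by fun_prop : Continuous fun x => k ^ 2 * f x ^ 2).intervalIntegrable _ _),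
    intervalIntegral.integral_const_mul] at hle
  linarith

lemma integral_sub_const_sq {f : ℝ → ℝ} (hf : Continuous f) (a b m : ℝ) :
    ∫ x in a..b, (f x - m) ^ 2 =
      (∫ x in a..b, f x ^ 2) - 2 * m * (∫ x in a..b, f x) + (b - a) * m ^ 2 := by
  have : (fun x => (f x - m) ^ 2) = fun x => f x ^ 2 - 2 * m * f x + m ^ 2 := by
    funext x; ring
  rw [this, intervalIntegral.integral_add, intervalIntegral.integral_sub,
    intervalIntegral.integral_const_mul, intervalIntegral.integral_const, smul_eq_mul] <;>
  exact Continuous.intervalIntegrable (by fun_prop) _ _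

/-- The variance is at most the mean square distance to any constant. -/
lemma variance_le {f : ℝ → ℝ} (hf : Continuous f) {a b : ℝ} (m : ℝ) :
    (b - a) * (∫ x in a..b, f x ^ 2) - (∫ x in a..b, f x) ^ 2 ≤
      (b - a) * ∫ x in a..b, (f x - m) ^ 2 := by
  rw [integral_sub_const_sq hf]
  nlinarith [sq_nonneg ((b - a) * m - ∫ x in a..b, f x)]

lemma sq_integral_le {f : ℝ → ℝ} (hf : Continuous f) {a b : ℝ} (hab : a < b) :
    (∫ x in a..b, f x) ^ 2 ≤ (b - a) * ∫ x in a..b, f x ^ 2 := by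
  have hba : 0 < b - a := sub_pos.2 hab
  have h0 : 0 ≤ ∫ x in a..b, (f x - (∫ x in a..b, f x) / (b - a)) ^ 2 :=
    intervalIntegral.integral_nonneg hab.le fun x _ => sq_nonneg _
  rw [integral_sub_const_sq hf] at h0
  have := mul_nonneg hba.le h0
  field_simp at this
  linarith

/-- Sharp Neumann Poincaré inequality on an interval. -/
lemma neumann_poincare {f f' : ℝ → ℝ} {a b : ℝ} (hab : a < b)
    (hf : ∀ x, HasDerivAt f (f' x) x) (hf' : Continuous f') :
    (π / (b - a)) ^ 2 * ((b - a) * (∫ x in a..b, f x ^ 2) - (∫ x in a..b, f x) ^ 2) ≤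
      (b - a) * ∫ x in a..b, f' x ^ 2 := by
  have hba : 0 < b - a := sub_pos.2 hab
  have hfc : Continuous f := continuous_iff_continuousAt.2 fun x => (hf x).continuousAt
  set m := (∫ x in a..b, f x) / (b - a) with hm
  set k := π / (b - a) with hk
  have hgc : Continuous fun x => f x - m := by fun_prop
  set G : ℝ → ℝ := fun x => ∫ t in a..x, (f t - m) with hG
  have hGd : ∀ x, HasDerivAt G (f x - m) x := fun x =>
    intervalIntegral.integral_hasDerivAt_right (hgc.intervalIntegrable a x)
      (hgc.stronglyMeasurableAtFilter _ _) hgc.continuousAt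
  have hGa : G a = 0 := by simp [hG]
  have hGb : G b = 0 := by
    simp only [hG]
    rw [intervalIntegral.integral_sub (hfc.intervalIntegrable _ _)
      (continuous_const.intervalIntegrable _ _), intervalIntegral.integral_const, smul_eq_mul, hm]
    field_simp
    ring
  have hGc : Continuous G := continuous_iff_continuousAt.2 fun x => (hGd x).continuousAt
  have hD := dirichlet_poincare hab hGd hgc hGa hGb
  have hP := intervalIntegral.integral_mul_deriv_eq_deriv_mul (a := a) (b := b)
    (fun x _ => (hf x).sub_const m) (fun x _ => hGd x) (hf'.intervalIntegrable _ _)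
    (hgc.intervalIntegrable _ _)
  rw [hGa, hGb] at hP
  have hsq : 0 ≤ ∫ x in a..b, (f' x + k ^ 2 * G x) ^ 2 :=
    intervalIntegral.integral_nonneg hab.le fun x _ => sq_nonneg _
  have hexp : ∫ x in a..b, (f' x + k ^ 2 * G x) ^ 2 = (∫ x in a..b, f' x ^ 2) +
      2 * k ^ 2 * (∫ x in a..b, f' x * G x) + k ^ 4 * ∫ x in a..b, G x ^ 2 := by
    have : (fun x => (f' x + k ^ 2 * G x) ^ 2) =
        fun x => f' x ^ 2 + 2 * k ^ 2 * (f' x * G x) + k ^ 4 * G x ^ 2 := by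
      funext x; ring
    rw [this, intervalIntegral.integral_add, intervalIntegral.integral_add,
      intervalIntegral.integral_const_mul, intervalIntegral.integral_const_mul] <;>
    exact Continuous.intervalIntegrable (by fun_prop) _ _
  have hsq' : ∫ x in a..b, (f x - m) * (f x - m) = ∫ x in a..b, (f x - m) ^ 2 := by
    simp only [sq]
  have hmain : k ^ 2 * (∫ x in a..b, (f x - m) ^ 2) ≤ ∫ x in a..b, f' x ^ 2 := by
    have := mul_le_mul_of_nonneg_left hD (sq_nonneg k)
    rw [hexp] at hsq
    rw [hsq'] at hP
    nlinarith
  calc _ ≤ k ^ 2 * ((b - a) * ∫ x in a..b, (f x - m) ^ 2) :=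
        mul_le_mul_of_nonneg_left (variance_le hfc m) (sq_nonneg k)
    _ = (b - a) * (k ^ 2 * ∫ x in a..b, (f x - m) ^ 2) := by ring
    _ ≤ _ := mul_le_mul_of_nonneg_left hmain hba.le

/-- Wirtinger's inequality for periodic functions. -/
lemma periodic_poincare {f f' : ℝ → ℝ} {L : ℝ} (hL : 0 < L)
    (hf : ∀ x, HasDerivAt f (f' x) x) (hf' : Continuous f') (hper : Function.Periodic f L) :
    (2 * π / L) ^ 2 * (L * (∫ x in (0 : ℝ)..L, f x ^ 2) - (∫ x in (0 : ℝ)..L, f x) ^ 2) ≤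
      L * ∫ x in (0 : ℝ)..L, f' x ^ 2 := by
  have hfc : Continuous f := continuous_iff_continuousAt.2 fun x => (hf x).continuousAt
  have hper' : Function.Periodic f' L := fun x => by
    have h1 : HasDerivAt (fun y => f (y + L)) (f' (x + L)) x := (hf (x + L)).comp_add_const x L
    rw [show (fun y => f (y + L)) = f from funext hper] at h1
    exact h1.unique (hf x)
  obtain ⟨c, hc⟩ : ∃ c, f (c + L / 2) = f c := by
    have hcont : Continuous fun x => f (x + L / 2) - f x := by fun_prop
    have hanti : f (L / 2 + L / 2) - f (L / 2) = -(f (0 + L / 2) - f 0) := by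
      have := hper 0
      rw [add_halves, zero_add] at *
      rw [this]; ring
    have h0 : (0 : ℝ) ∈ range fun x => f (x + L / 2) - f x := by
      rcases le_total (f (0 + L / 2) - f 0) 0 with h | h
      · exact mem_range_of_exists_le_of_exists_ge hcont ⟨0, h⟩ ⟨L / 2, by rw [hanti]; linarith⟩
      · exact mem_range_of_exists_le_of_exists_ge hcont ⟨L / 2, by rw [hanti]; linarith⟩ ⟨0, h⟩
    obtain ⟨c, hc⟩ := h0
    exact ⟨c, sub_eq_zero.1 hc⟩
  have hgd : ∀ x, HasDerivAt (fun x => f x - f c) (f' x) x := fun x => (hf x).sub_const _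
  have hgc : Continuous fun x => (f x - f c) ^ 2 := by fun_prop
  have hfc2 : Continuous fun x => f' x ^ 2 := by fun_prop
  have h1 := dirichlet_poincare (a := c) (b := c + L / 2) (by linarith) hgd hf' (by simp)
    (by simp [hc])
  have h2 := dirichlet_poincare (a := c + L / 2) (b := c + L) (by linarith) hgd hf'
    (by simp [hc]) (by simp [hper c])
  have e1 : π / (c + L / 2 - c) = 2 * π / L := by
    rw [add_sub_cancel_left]; field_simp
  have e2 : π / (c + L - (c + L / 2)) = 2 * π / L := by
    rw [show c + L - (c + L / 2) = L / 2 by ring]; field_simp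
  rw [e1] at h1
  rw [e2] at h2
  have s1 := intervalIntegral.integral_add_adjacent_intervals
    (hgc.intervalIntegrable (μ := volume) c (c + L / 2)) (hgc.intervalIntegrable _ (c + L))
  have s2 := intervalIntegral.integral_add_adjacent_intervals
    (hfc2.intervalIntegrable (μ := volume) c (c + L / 2))
    (hfc2.intervalIntegrable _ (c + L))
  have p1 : Function.Periodic (fun x => (f x - f c) ^ 2) L := fun x => by simp only [hper x]
  have p2 : Function.Periodic (fun x => f' x ^ 2) L := fun x => by simp only [hper' x]
  have t1 := p1.intervalIntegral_add_eq c 0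
  have t2 := p2.intervalIntegral_add_eq c 0
  rw [zero_add] at t1 t2
  have hmain : (2 * π / L) ^ 2 * (∫ x in (0 : ℝ)..L, (f x - f c) ^ 2) ≤
      ∫ x in (0 : ℝ)..L, f' x ^ 2 := by
    rw [← t1, ← t2, ← s1, ← s2]
    linarith
  have hv := variance_le hfc (a := 0) (b := L) (f c)
  rw [sub_zero] at hv
  calc _ ≤ (2 * π / L) ^ 2 * (L * ∫ x in (0 : ℝ)..L, (f x - f c) ^ 2) :=
        mul_le_mul_of_nonneg_left hv (sq_nonneg _)
    _ = L * ((2 * π / L) ^ 2 * ∫ x in (0 : ℝ)..L, (f x - f c) ^ 2) := by ring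
    _ ≤ _ := mul_le_mul_of_nonneg_left hmain hL.le

/-- Differentiation under the integral sign for jointly continuous data. -/
lemma hasDerivAt_parametric_integral {f f' : ℝ → ℝ → ℝ}
    (hf : Continuous fun p : ℝ × ℝ => f p.1 p.2)
    (hf' : Continuous fun p : ℝ × ℝ => f' p.1 p.2)
    (hd : ∀ t s, HasDerivAt (fun t => f t s) (f' t s) t) (a b t : ℝ) :
    HasDerivAt (fun t => ∫ s in a..b, f t s) (∫ s in a..b, f' t s) t := by
  have hcomp : IsCompact (Metric.closedBall t 1 ×ˢ uIcc a b) :=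
    (isCompact_closedBall t 1).prod isCompact_uIcc
  obtain ⟨C, hC⟩ := hcomp.exists_bound_of_continuousOn hf'.continuousOn
  refine (intervalIntegral.hasDerivAt_integral_of_dominated_loc_of_deriv_le
    (F := f) (F' := f') (bound := fun _ => C) (s := Metric.closedBall t 1)
    (Metric.closedBall_mem_nhds t one_pos) ?_ ?_ ?_ ?_ ?_ ?_).2
  · exact Filter.Eventually.of_forall fun x =>
      (hf.comp (by fun_prop : Continuous fun s : ℝ => (x, s))).aestronglyMeasurable
  · exact (hf.comp (by fun_prop : Continuous fun s : ℝ => (t, s))).intervalIntegrable _ _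
  · exact (hf'.comp (by fun_prop : Continuous fun s : ℝ => (t, s))).aestronglyMeasurable
  · exact Filter.Eventually.of_forall fun s hs x hx => hC (x, s) ⟨hx, uIoc_subset_uIcc hs⟩
  · exact continuous_const.intervalIntegrable _ _
  · exact Filter.Eventually.of_forall fun s _ x _ => hd x s

lemma integral_mono_of_linear_le {p q r : ℝ → ℝ} {a b l c c' : ℝ} (hab : a ≤ b)
    (hp : Continuous p) (hq : Continuous q) (hr : Continuous r)
    (h : ∀ x, l * (c * p x - q x) ≤ c' * r x) :
    l * (c * (∫ x in a..b, p x) - ∫ x in a..b, q x) ≤ c' * ∫ x in a..b, r x := by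
  have := intervalIntegral.integral_mono (μ := volume) hab
    ((by fun_prop : Continuous fun x => l * (c * p x - q x)).intervalIntegrable _ _)
    ((by fun_prop : Continuous fun x => c' * r x).intervalIntegrable _ _) h
  rwa [intervalIntegral.integral_const_mul, intervalIntegral.integral_const_mul,
    intervalIntegral.integral_sub
      ((by fun_prop : Continuous fun x => c * p x).intervalIntegrable _ _)
      (hq.intervalIntegrable _ _), intervalIntegral.integral_const_mul] at this

/-- Poincaré inequality on a box for functions periodic in the first two variables, obtained by
tensorizing the one-dimensional inequalities. -/
lemma slab_poincare_iterated {f fx fy fz : ℝ → ℝ → ℝ → ℝ} {L₁ L₂ d l : ℝ}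
    (hL₁ : 0 < L₁) (hL₂ : 0 < L₂) (hd : 0 < d)
    (hl₁ : l ≤ (2 * π / L₁) ^ 2) (hl₂ : l ≤ (2 * π / L₂) ^ 2) (hl₃ : l ≤ (π / d) ^ 2)
    (hf : Continuous fun p : ℝ × ℝ × ℝ => f p.1 p.2.1 p.2.2)
    (hfx : Continuous fun p : ℝ × ℝ × ℝ => fx p.1 p.2.1 p.2.2)
    (hfy : Continuous fun p : ℝ × ℝ × ℝ => fy p.1 p.2.1 p.2.2)
    (hfz : Continuous fun p : ℝ × ℝ × ℝ => fz p.1 p.2.1 p.2.2)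
    (hdx : ∀ x y z, HasDerivAt (fun x => f x y z) (fx x y z) x)
    (hdy : ∀ x y z, HasDerivAt (fun y => f x y z) (fy x y z) y)
    (hdz : ∀ x y z, HasDerivAt (fun z => f x y z) (fz x y z) z)
    (hpx : ∀ x y z, f (x + L₁) y z = f x y z) (hpy : ∀ x y z, f x (y + L₂) z = f x y z) :
    l * (L₁ * L₂ * d * (∫ x in (0 : ℝ)..L₁, ∫ y in (0 : ℝ)..L₂, ∫ z in (-d)..0, f x y z ^ 2) -
        (∫ x in (0 : ℝ)..L₁, ∫ y in (0 : ℝ)..L₂, ∫ z in (-d)..0, f x y z) ^ 2) ≤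
      L₁ * L₂ * d *
        ((∫ x in (0 : ℝ)..L₁, ∫ y in (0 : ℝ)..L₂, ∫ z in (-d)..0, fx x y z ^ 2) +
        (∫ x in (0 : ℝ)..L₁, ∫ y in (0 : ℝ)..L₂, ∫ z in (-d)..0, fy x y z ^ 2) +
        ∫ x in (0 : ℝ)..L₁, ∫ y in (0 : ℝ)..L₂, ∫ z in (-d)..0, fz x y z ^ 2) := by
  have hd' : -d < 0 := by linarith
  have hcomp {g : ℝ → ℝ → ℝ → ℝ} (hg : Continuous fun p : ℝ × ℝ × ℝ => g p.1 p.2.1 p.2.2)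
      {X : Type} [TopologicalSpace X] {a b c : X → ℝ} (ha : Continuous a) (hb : Continuous b)
      (hc : Continuous c) : Continuous fun t => g (a t) (b t) (c t) :=
    hg.comp (ha.prodMk (hb.prodMk hc))
  have hint {g : ℝ → ℝ → ℝ → ℝ} (hg : Continuous fun p : ℝ × ℝ × ℝ => g p.1 p.2.1 p.2.2) :
      Continuous fun p : ℝ × ℝ => ∫ z in (-d)..0, g p.1 p.2 z :=
    intervalIntegral.continuous_parametric_intervalIntegral_of_continuous'
      (f := fun (p : ℝ × ℝ) z => g p.1 p.2 z)
      (hcomp hg (by fun_prop) (by fun_prop) (by fun_prop)) _ _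
  have hint2 {g : ℝ → ℝ → ℝ} (hg : Continuous fun p : ℝ × ℝ => g p.1 p.2) :
      Continuous fun x => ∫ y in (0 : ℝ)..L₂, g x y :=
    intervalIntegral.continuous_parametric_intervalIntegral_of_continuous' (f := g) hg _ _
  have hsec {g : ℝ → ℝ → ℝ} (hg : Continuous fun p : ℝ × ℝ => g p.1 p.2) (x : ℝ) :
      Continuous fun y => g x y := hg.comp (by fun_prop : Continuous fun y : ℝ => (x, y))
  have weaken {g : ℝ → ℝ} (hg : Continuous g) {a b k : ℝ} (hab : a < b) (hk : l ≤ k) :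
      l * ((b - a) * (∫ x in a..b, g x ^ 2) - (∫ x in a..b, g x) ^ 2) ≤
        k * ((b - a) * (∫ x in a..b, g x ^ 2) - (∫ x in a..b, g x) ^ 2) :=
    mul_le_mul_of_nonneg_right hk (sub_nonneg.2 (sq_integral_le hg hab))
  set F : ℝ → ℝ → ℝ := fun x y => ∫ z in (-d)..0, f x y z with hF
  set G : ℝ → ℝ := fun x => ∫ y in (0 : ℝ)..L₂, F x y with hG
  set P : ℝ → ℝ → ℝ := fun x y => ∫ z in (-d)..0, f x y z ^ 2 with hP
  set R₁ : ℝ → ℝ → ℝ := fun x y => ∫ z in (-d)..0, fx x y z ^ 2 with hR₁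
  set R₂ : ℝ → ℝ → ℝ := fun x y => ∫ z in (-d)..0, fy x y z ^ 2 with hR₂
  set R₃ : ℝ → ℝ → ℝ := fun x y => ∫ z in (-d)..0, fz x y z ^ 2 with hR₃
  have cF : Continuous fun p : ℝ × ℝ => F p.1 p.2 := hint hf
  have cP : Continuous fun p : ℝ × ℝ => P p.1 p.2 :=
    hint (g := fun x y z => f x y z ^ 2) (hf.pow 2)
  have cR₁ : Continuous fun p : ℝ × ℝ => R₁ p.1 p.2 :=
    hint (g := fun x y z => fx x y z ^ 2) (hfx.pow 2)
  have cR₂ : Continuous fun p : ℝ × ℝ => R₂ p.1 p.2 :=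
    hint (g := fun x y z => fy x y z ^ 2) (hfy.pow 2)
  have cR₃ : Continuous fun p : ℝ × ℝ => R₃ p.1 p.2 :=
    hint (g := fun x y z => fz x y z ^ 2) (hfz.pow 2)
  have cF2 : Continuous fun p : ℝ × ℝ => F p.1 p.2 ^ 2 := cF.pow 2
  have cG : Continuous G := hint2 cF
  -- the vertical variable
  have hz : l * (d * (∫ x in (0 : ℝ)..L₁, ∫ y in (0 : ℝ)..L₂, P x y) -
      ∫ x in (0 : ℝ)..L₁, ∫ y in (0 : ℝ)..L₂, F x y ^ 2) ≤
      d * ∫ x in (0 : ℝ)..L₁, ∫ y in (0 : ℝ)..L₂, R₃ x y := by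
    refine integral_mono_of_linear_le hL₁.le (hint2 cP) (hint2 (g := fun x y => F x y ^ 2) cF2)
      (hint2 cR₃) fun x => ?_
    refine integral_mono_of_linear_le hL₂.le (hsec cP x) (hsec (g := fun x y => F x y ^ 2) cF2 x)
      (hsec cR₃ x) fun y => ?_
    have h1 := neumann_poincare hd' (hdz x y)
      (hcomp hfz continuous_const continuous_const continuous_id)
    have h2 := weaken (hcomp hf (continuous_const (y := x)) (continuous_const (y := y))
      continuous_id) hd' (by simpa using hl₃ : l ≤ (π / (0 - -d)) ^ 2)
    simpa using h2.trans h1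
  -- the second horizontal variable
  have hy : l * (L₂ * (∫ x in (0 : ℝ)..L₁, ∫ y in (0 : ℝ)..L₂, F x y ^ 2) -
      ∫ x in (0 : ℝ)..L₁, G x ^ 2) ≤
      L₂ * d * ∫ x in (0 : ℝ)..L₁, ∫ y in (0 : ℝ)..L₂, R₂ x y := by
    refine integral_mono_of_linear_le hL₁.le (hint2 (g := fun x y => F x y ^ 2) cF2) (cG.pow 2)
      (hint2 cR₂) fun x => ?_
    have hFd : ∀ y, HasDerivAt (fun y => F x y) (∫ z in (-d)..0, fy x y z) y := fun y =>
      hasDerivAt_parametric_integral (f := fun y z => f x y z) (f' := fun y z => fy x y z)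
        (hcomp hf (by fun_prop) (by fun_prop) (by fun_prop))
        (hcomp hfy (by fun_prop) (by fun_prop) (by fun_prop)) (fun y z => hdy x y z) _ _ y
    have h1 := periodic_poincare hL₂ hFd (hsec (g := fun x y => ∫ z in (-d)..0, fy x y z) (hint hfy) x)
      (fun y => by simp only [hF, hpy])
    have h2 := weaken (hsec cF x) hL₂ (by simpa using hl₂)
    rw [sub_zero] at h2
    have h3 : ∫ y in (0 : ℝ)..L₂, (∫ z in (-d)..0, fy x y z) ^ 2 ≤
        ∫ y in (0 : ℝ)..L₂, d * R₂ x y := by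
      refine intervalIntegral.integral_mono hL₂.le
        (((hsec (g := fun x y => ∫ z in (-d)..0, fy x y z) (hint hfy) x).pow 2).intervalIntegrable _ _)
        (((hsec cR₂ x).const_mul d).intervalIntegrable _ _) fun y => ?_
      simpa using sq_integral_le (hcomp hfy (continuous_const (y := x))
        (continuous_const (y := y)) continuous_id) hd'
    rw [intervalIntegral.integral_const_mul] at h3
    calc _ ≤ _ := h2
      _ ≤ _ := h1
      _ ≤ L₂ * (d * ∫ y in (0 : ℝ)..L₂, R₂ x y) := mul_le_mul_of_nonneg_left h3 hL₂.le
      _ = _ := by ring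
  -- the first horizontal variable
  have hx : l * (L₁ * (∫ x in (0 : ℝ)..L₁, G x ^ 2) - (∫ x in (0 : ℝ)..L₁, G x) ^ 2) ≤
      L₁ * L₂ * d * ∫ x in (0 : ℝ)..L₁, ∫ y in (0 : ℝ)..L₂, R₁ x y := by
    set H : ℝ → ℝ → ℝ := fun x y => ∫ z in (-d)..0, fx x y z with hH
    have cH : Continuous fun p : ℝ × ℝ => H p.1 p.2 := hint hfx
    have hFd : ∀ x y, HasDerivAt (fun x => F x y) (H x y) x := fun x y =>
      hasDerivAt_parametric_integral (f := fun x z => f x y z) (f' := fun x z => fx x y z)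
        (hcomp hf (by fun_prop) (by fun_prop) (by fun_prop))
        (hcomp hfx (by fun_prop) (by fun_prop) (by fun_prop)) (fun x z => hdx x y z) _ _ x
    have hGd : ∀ x, HasDerivAt G (∫ y in (0 : ℝ)..L₂, H x y) x := fun x =>
      hasDerivAt_parametric_integral cF cH hFd _ _ x
    have h1 := periodic_poincare hL₁ hGd (hint2 cH) (fun x => by simp only [hG, hF, hpx])
    have h2 := weaken cG hL₁ (by simpa using hl₁)
    rw [sub_zero] at h2
    have h3 : ∫ x in (0 : ℝ)..L₁, (∫ y in (0 : ℝ)..L₂, H x y) ^ 2 ≤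
        ∫ x in (0 : ℝ)..L₁, L₂ * d * ∫ y in (0 : ℝ)..L₂, R₁ x y := by
      refine intervalIntegral.integral_mono hL₁.le
        (((hint2 cH).pow 2).intervalIntegrable _ _)
        (((hint2 cR₁).const_mul _).intervalIntegrable _ _) fun x => ?_
      have h4 : ∫ y in (0 : ℝ)..L₂, H x y ^ 2 ≤ ∫ y in (0 : ℝ)..L₂, d * R₁ x y := by
        refine intervalIntegral.integral_mono hL₂.le
          (((hsec cH x).pow 2).intervalIntegrable _ _)
          (((hsec cR₁ x).const_mul d).intervalIntegrable _ _) fun y => ?_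
        simpa using sq_integral_le (hcomp hfx (continuous_const (y := x))
          (continuous_const (y := y)) continuous_id) hd'
      rw [intervalIntegral.integral_const_mul] at h4
      have h5 := sq_integral_le (hsec cH x) hL₂
      rw [sub_zero] at h5
      calc _ ≤ _ := h5
        _ ≤ L₂ * (d * ∫ y in (0 : ℝ)..L₂, R₁ x y) := mul_le_mul_of_nonneg_left h4 hL₂.le
        _ = _ := by ring
    rw [intervalIntegral.integral_const_mul] at h3
    calc _ ≤ _ := h2
      _ ≤ _ := h1
      _ ≤ L₁ * (L₂ * d * ∫ x in (0 : ℝ)..L₁, ∫ y in (0 : ℝ)..L₂, R₁ x y) :=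
        mul_le_mul_of_nonneg_left h3 hL₁.le
      _ = _ := by ring
  have hz' := mul_le_mul_of_nonneg_left hz (mul_pos hL₁ hL₂).le
  have hy' := mul_le_mul_of_nonneg_left hy hL₁.le
  linarith

lemma Continuous.integrableOn_slab {F : (Fin 3 → ℝ) → ℝ} (hF : Continuous F) (L₁ L₂ d : ℝ) :
    IntegrableOn F (slab L₁ L₂ d) := by
  refine (hF.integrableOn_Icc (a := ![0, 0, -d]) (b := ![L₁, L₂, 0])).mono_set ?_
  rw [← pi_univ_Icc]
  refine pi_mono fun i _ => ?_
  fin_cases i <;> exact Ioo_subset_Icc_self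

/-- Integration over the slab as an iterated integral. -/
lemma integral_slab {F : (Fin 3 → ℝ) → ℝ} (hF : Continuous F) {L₁ L₂ d : ℝ}
    (hL₁ : 0 < L₁) (hL₂ : 0 < L₂) (hd : 0 < d) :
    ∫ x in slab L₁ L₂ d, F x =
      ∫ x in (0 : ℝ)..L₁, ∫ y in (0 : ℝ)..L₂, ∫ z in (-d)..0, F ![x, y, z] := by
  have hd' : -d ≤ 0 := by linarith
  simp only [intervalIntegral.integral_of_le hL₁.le, intervalIntegral.integral_of_le hL₂.le,
    intervalIntegral.integral_of_le hd', integral_Ioc_eq_integral_Ioo]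
  set μ : Fin 3 → Measure ℝ := fun i => volume.restrict
    ((![Ioo 0 L₁, Ioo 0 L₂, Ioo (-d) 0] : Fin 3 → Set ℝ) i) with hμ
  have hvol : (volume : Measure (Fin 3 → ℝ)).restrict (slab L₁ L₂ d) = Measure.pi μ := by
    rw [slab, volume_pi, Measure.restrict_pi_pi]
  have hFi : Integrable F (Measure.pi μ) := by
    rw [← hvol]; exact hF.integrableOn_slab L₁ L₂ d
  have m1 := (measurePreserving_piFinSuccAbove μ 0).symm
  have m2 := (measurePreserving_piFinTwo fun j : Fin 2 => μ ((0 : Fin 3).succAbove j)).symm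
  have hcons : ∀ x, Integrable (fun p : ℝ × ℝ => F ![x, p.1, p.2])
      ((volume.restrict (Ioo 0 L₂)).prod (volume.restrict (Ioo (-d) 0))) := by
    intro x
    rw [Measure.prod_restrict]
    have hc : Continuous fun p : ℝ × ℝ => F ![x, p.1, p.2] := by fun_prop
    refine (hc.integrableOn_Icc (a := (0, -d)) (b := (L₂, 0))).mono_set ?_
    rw [← Icc_prod_Icc]
    exact prod_mono Ioo_subset_Icc_self Ioo_subset_Icc_self
  rw [hvol, ← m1.integral_comp']
  refine (integral_prod _ (m1.integrable_comp_of_integrable hFi)).trans ?_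
  refine integral_congr_ae (Filter.Eventually.of_forall fun x => ?_)
  dsimp only
  rw [← m2.integral_comp']
  refine Eq.trans ?_ (integral_prod _ (hcons x))
  refine integral_congr_ae (Filter.Eventually.of_forall fun p => ?_)
  refine congrArg F (funext fun i => ?_)
  fin_cases i <;> rfl

lemma continuous_pd {f : (Fin 3 → ℝ) → ℝ} (hf : ContDiff ℝ 1 f) (i : Fin 3) :
    Continuous (pd i f) :=
  (hf.continuous_fderiv one_ne_zero).clm_apply continuous_const

lemma hasDerivAt_comp_curve {f : (Fin 3 → ℝ) → ℝ} (hf : ContDiff ℝ 1 f) (i : Fin 3)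
    {γ : ℝ → Fin 3 → ℝ} {t : ℝ} (hγ : HasDerivAt γ (Pi.single i 1) t) :
    HasDerivAt (fun s => f (γ s)) (pd i f (γ t)) t :=
  ((hf.differentiable one_ne_zero (γ t)).hasFDerivAt).comp_hasDerivAt t hγ

/-- Sharp Poincaré inequality on the slab for functions periodic in the horizontal variables. -/
lemma slab_poincare {φ : (Fin 3 → ℝ) → ℝ} {L₁ L₂ d l : ℝ}
    (hL₁ : 0 < L₁) (hL₂ : 0 < L₂) (hd : 0 < d)
    (hl₁ : l ≤ (2 * π / L₁) ^ 2) (hl₂ : l ≤ (2 * π / L₂) ^ 2) (hl₃ : l ≤ (π / d) ^ 2)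
    (hφ : ContDiff ℝ 1 φ) (hp1 : ∀ x, φ (x + Pi.single 0 L₁) = φ x)
    (hp2 : ∀ x, φ (x + Pi.single 1 L₂) = φ x) :
    l * (L₁ * L₂ * d * (∫ x in slab L₁ L₂ d, φ x ^ 2) - (∫ x in slab L₁ L₂ d, φ x) ^ 2) ≤
      L₁ * L₂ * d * ∫ x in slab L₁ L₂ d, ∑ i, pd i φ x ^ 2 := by
  have hc := hφ.continuous
  have hpd := continuous_pd hφ
  have hsum : ∫ x in slab L₁ L₂ d, ∑ i, pd i φ x ^ 2 =
      ∑ i, ∫ x in slab L₁ L₂ d, pd i φ x ^ 2 :=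
    integral_finsetSum _ fun i _ => ((hpd i).pow 2).integrableOn_slab _ _ _
  have hvec : Continuous fun p : ℝ × ℝ × ℝ => ![p.1, p.2.1, p.2.2] := by fun_prop
  have hpdi (i : Fin 3) := integral_slab (F := fun x => pd i φ x ^ 2) ((hpd i).pow 2) hL₁ hL₂ hd
  rw [hsum, Fin.sum_univ_three, integral_slab (F := fun x => φ x ^ 2) (hc.pow 2) hL₁ hL₂ hd,
    integral_slab hc hL₁ hL₂ hd, hpdi, hpdi, hpdi]
  refine slab_poincare_iterated (f := fun x y z => φ ![x, y, z])
    (fx := fun x y z => pd 0 φ ![x, y, z]) (fy := fun x y z => pd 1 φ ![x, y, z])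
    (fz := fun x y z => pd 2 φ ![x, y, z]) hL₁ hL₂ hd hl₁ hl₂ hl₃ (hc.comp hvec)
    ((hpd 0).comp hvec) ((hpd 1).comp hvec) ((hpd 2).comp hvec) ?_ ?_ ?_ ?_ ?_
  · intro x y z
    refine hasDerivAt_comp_curve hφ 0 (γ := fun x => ![x, y, z]) (hasDerivAt_pi.2 fun i => ?_)
    fin_cases i
    exacts [hasDerivAt_id x, hasDerivAt_const x y, hasDerivAt_const x z]
  · intro x y z
    refine hasDerivAt_comp_curve hφ 1 (γ := fun y => ![x, y, z]) (hasDerivAt_pi.2 fun i => ?_)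
    fin_cases i
    exacts [hasDerivAt_const y x, hasDerivAt_id y, hasDerivAt_const y z]
  · intro x y z
    refine hasDerivAt_comp_curve hφ 2 (γ := fun z => ![x, y, z]) (hasDerivAt_pi.2 fun i => ?_)
    fin_cases i
    exacts [hasDerivAt_const z x, hasDerivAt_const z y, hasDerivAt_id z]
  · intro x y z
    rw [← hp1 ![x, y, z]]
    congr 1
    ext i
    fin_cases i <;> simp
  · intro x y z
    rw [← hp2 ![x, y, z]]
    congr 1
    ext i
    fin_cases i <;> simp

/-- **Coercivity of the moving-boundary dissipation functional in the insulating case,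
on `J`-weighted mean-zero functions.**  With `J = det ∇Φ`, `𝒜 = (∇Φ⁻¹)ᵀ`, assuming
`1/c₀ ≤ J ≤ c₀` and `(1/c₁)|v|² ≤ (J𝒜ᵀ𝒜v)·v ≤ c₁|v|²`, every `C¹` horizontally
periodic `φ` with `∫_Ω Jφ = 0` satisfies
`(μ̄₀/(c₀c₁)) ∫_Ω |φ|² J ≤ κ ∫_Ω J|∇_𝒜φ|²` where
`μ̄₀ = κπ² min{1/d², 4/L₁², 4/L₂²}`. -/
theorem moving_coercivity_neumann
    (d κ L₁ L₂ c₀ c₁ : ℝ)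
    (hd : 0 < d) (hκ : 0 < κ) (hL₁ : 0 < L₁) (hL₂ : 0 < L₂)
    (hc₀ : 1 < c₀) (hc₁ : 0 < c₁)
    (ηb : (Fin 3 → ℝ) → ℝ) (hηb : ContDiff ℝ 1 ηb)
    (hη_per1 : ∀ x, ηb (x + Pi.single 0 L₁) = ηb x)
    (hη_per2 : ∀ x, ηb (x + Pi.single 1 L₂) = ηb x)
    (A B J K : (Fin 3 → ℝ) → ℝ) (𝒜 : (Fin 3 → ℝ) → Matrix (Fin 3) (Fin 3) ℝ)
    (hA : ∀ x, A x = pd 0 ηb x * (1 + x 2 / d))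
    (hB : ∀ x, B x = pd 1 ηb x * (1 + x 2 / d))
    (hJ : ∀ x, J x = 1 + ηb x / d + pd 2 ηb x * (1 + x 2 / d))
    (hK : ∀ x, K x = (J x)⁻¹)
    (h𝒜 : ∀ x, 𝒜 x =
      !![1, 0, -(A x * K x); 0, 1, -(B x * K x); 0, 0, K x])
    (hJbd : ∀ x, 1 / c₀ ≤ J x ∧ J x ≤ c₀)
    (hc₁bd : ∀ x, ∀ v : Fin 3 → ℝ,
      (1 / c₁) * (∑ i, (v i) ^ 2) ≤ J x * ∑ i, (∑ k, 𝒜 x i k * v k) ^ 2 ∧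
      J x * (∑ i, (∑ k, 𝒜 x i k * v k) ^ 2) ≤ c₁ * ∑ i, (v i) ^ 2)
    (φ : (Fin 3 → ℝ) → ℝ) (hφ : ContDiff ℝ 1 φ)
    (hφ_per1 : ∀ x, φ (x + Pi.single 0 L₁) = φ x)
    (hφ_per2 : ∀ x, φ (x + Pi.single 1 L₂) = φ x)
    (hmean : (∫ x in slab L₁ L₂ d, J x * φ x) = 0) :
    κ * π ^ 2 * min (1 / d ^ 2) (min (4 / L₁ ^ 2) (4 / L₂ ^ 2)) / (c₀ * c₁) *
        (∫ x in slab L₁ L₂ d, (φ x) ^ 2 * J x) ≤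
      κ * (∫ x in slab L₁ L₂ d, J x * ∑ i, (∑ k, 𝒜 x i k * pd k φ x) ^ 2) := by
  have hJc : Continuous J := by
    have := continuous_pd hηb 2
    have := hηb.continuous
    rw [funext hJ]
    fun_prop
  have hJpos : ∀ x, 0 < J x := fun x =>
    (one_div_pos.2 (zero_lt_one.trans hc₀)).trans_le (hJbd x).1
  have hKc : Continuous K := by
    rw [funext hK]
    exact hJc.inv₀ fun x => (hJpos x).ne'
  have hAc : Continuous A := by
    have := continuous_pd hηb 0
    rw [funext hA]
    fun_prop
  have hBc : Continuous B := by
    have := continuous_pd hηb 1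
    rw [funext hB]
    fun_prop
  have h𝒜c : Continuous 𝒜 := by
    rw [funext h𝒜]
    refine continuous_matrix fun i j => ?_
    fin_cases i <;> fin_cases j <;> simp <;> fun_prop
  have hφc := hφ.continuous
  have hpd := continuous_pd hφ
  have hc₀' : 0 < c₀ := by linarith
  set l := π ^ 2 * min (1 / d ^ 2) (min (4 / L₁ ^ 2) (4 / L₂ ^ 2)) with hl
  have hl0 : 0 < l := by positivity
  have hpi : 0 ≤ π ^ 2 := sq_nonneg π
  have hl₁ : l ≤ (2 * π / L₁) ^ 2 :=
    (mul_le_mul_of_nonneg_left ((min_le_right _ _).trans (min_le_left _ _)) hpi).trans_eq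
      (by ring)
  have hl₂ : l ≤ (2 * π / L₂) ^ 2 :=
    (mul_le_mul_of_nonneg_left ((min_le_right _ _).trans (min_le_right _ _)) hpi).trans_eq
      (by ring)
  have hl₃ : l ≤ (π / d) ^ 2 :=
    (mul_le_mul_of_nonneg_left (min_le_left _ _) hpi).trans_eq (by ring)
  set V := L₁ * L₂ * d with hV
  have hV0 : 0 < V := by positivity
  have hP := slab_poincare hL₁ hL₂ hd hl₁ hl₂ hl₃ hφ hφ_per1 hφ_per2
  set m := (∫ x in slab L₁ L₂ d, φ x) / V with hm
  have hone : ∫ _ in slab L₁ L₂ d, m ^ 2 = V * m ^ 2 := by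
    rw [integral_slab continuous_const hL₁ hL₂ hd]
    simp only [intervalIntegral.integral_const, smul_eq_mul]
    ring
  have hvar : ∫ x in slab L₁ L₂ d, (φ x - m) ^ 2 =
      (∫ x in slab L₁ L₂ d, φ x ^ 2) - 2 * m * (∫ x in slab L₁ L₂ d, φ x) + V * m ^ 2 := by
    have : (fun x => (φ x - m) ^ 2) = fun x => φ x ^ 2 - 2 * m * φ x + m ^ 2 := by
      funext x; ring
    rw [this, integral_add, integral_sub, integral_const_mul, hone] <;>
    exact Continuous.integrableOn_slab (by fun_prop) _ _ _
  have hweighted : (∫ x in slab L₁ L₂ d, φ x ^ 2 * J x) ≤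
      ∫ x in slab L₁ L₂ d, (φ x - m) ^ 2 * J x := by
    have : (fun x => (φ x - m) ^ 2 * J x) =
        fun x => φ x ^ 2 * J x - 2 * m * (J x * φ x) + m ^ 2 * J x := by
      funext x; ring
    have h0 : 0 ≤ ∫ x in slab L₁ L₂ d, m ^ 2 * J x :=
      integral_nonneg fun x => mul_nonneg (sq_nonneg m) (hJpos x).le
    rw [this, integral_add, integral_sub, integral_const_mul (2 * m), hmean]
    · linarith
    all_goals exact Continuous.integrableOn_slab (by fun_prop) _ _ _
  have hupper : (∫ x in slab L₁ L₂ d, (φ x - m) ^ 2 * J x) ≤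
      c₀ * ∫ x in slab L₁ L₂ d, (φ x - m) ^ 2 := by
    rw [← integral_const_mul]
    refine integral_mono (Continuous.integrableOn_slab (by fun_prop) _ _ _)
      (Continuous.integrableOn_slab (by fun_prop) _ _ _) fun x => ?_
    simpa only [mul_comm c₀] using mul_le_mul_of_nonneg_left (hJbd x).2 (sq_nonneg (φ x - m))
  have hrigid : l * (∫ x in slab L₁ L₂ d, (φ x - m) ^ 2) ≤
      ∫ x in slab L₁ L₂ d, ∑ i, pd i φ x ^ 2 := by
    have hT : (∫ x in slab L₁ L₂ d, φ x) = V * m := by rw [hm]; field_simp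
    rw [hT] at hP hvar
    rw [hvar]
    refine le_of_mul_le_mul_left ?_ hV0
    linarith
  have hcoer : (∫ x in slab L₁ L₂ d, ∑ i, pd i φ x ^ 2) ≤
      c₁ * ∫ x in slab L₁ L₂ d, J x * ∑ i, (∑ k, 𝒜 x i k * pd k φ x) ^ 2 := by
    rw [← integral_const_mul]
    refine integral_mono (Continuous.integrableOn_slab (by fun_prop) _ _ _)
      (Continuous.integrableOn_slab (by fun_prop) _ _ _) fun x => ?_
    have := mul_le_mul_of_nonneg_left (hc₁bd x fun k => pd k φ x).1 hc₁.le
    rwa [← mul_assoc, mul_one_div_cancel hc₁.ne', one_mul] at this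
  set X := ∫ x in slab L₁ L₂ d, φ x ^ 2 * J x
  set Y := ∫ x in slab L₁ L₂ d, J x * ∑ i, (∑ k, 𝒜 x i k * pd k φ x) ^ 2
  have hfinal : l * X ≤ c₀ * c₁ * Y :=
    calc l * X ≤ l * (c₀ * ∫ x in slab L₁ L₂ d, (φ x - m) ^ 2) :=
          mul_le_mul_of_nonneg_left (hweighted.trans hupper) hl0.le
      _ = c₀ * (l * ∫ x in slab L₁ L₂ d, (φ x - m) ^ 2) := by ring
      _ ≤ c₀ * (c₁ * Y) := mul_le_mul_of_nonneg_left (hrigid.trans hcoer) hc₀'.le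
      _ = c₀ * c₁ * Y := by ring
  rw [mul_assoc κ, ← hl, div_mul_eq_mul_div, div_le_iff₀ (mul_pos hc₀' hc₁)]
  calc κ * l * X = κ * (l * X) := by ring
    _ ≤ κ * (c₀ * c₁ * Y) := mul_le_mul_of_nonneg_left hfinal hκ.le
    _ = κ * Y * (c₀ * c₁) := by ring
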